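/- Let F be a field and A ∈ F a nonzero element; set q = A², {k} = (-A)^k - (-A)^{-k}, {n}! = {1}···{n} with {0}! = 1, λ_i = -q^{i+1} - q^{-i-1}, and C^l_{m,n} = (-1)^l {m}!{n}!{m+n+1}!/({m-l}!{n-l}!{m+n+1-l}!{l}!). For c ≥ 0 let Q_{n,c}(z) = ∏_{i=c}^{c+n-1}(z - λ_i) ∈ F[z] (so Q_{n,0} = Q_n). Fix m, n, c ≥ 0 and assume {k} ≠ 0 for all 1 ≤ k ≤ m+n+c+1. Then in F[z] one has Q_m · Q_{n,c} = ∑_{l=0}^{min(m, n+c)} C^l_{m,n+c} · Q_{m+n-l,c}. -/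

import Mathlib

open Finset Polynomial

/-- Quantum integer `{k} = (-A)^k - (-A)^(-k)`. -/
noncomputable def qint {F : Type*} [Field F] (A : F) (k : ℤ) : F :=
  (-A) ^ k - (-A) ^ (-k)

/-- Quantum factorial `{n}! = {1}{2}⋯{n}`, with `{0}! = 1`. -/
noncomputable def qfact {F : Type*} [Field F] (A : F) (n : ℕ) : F :=
  ∏ k ∈ Finset.range n, qint A ((k : ℤ) + 1)

/-- `λ_i = -q^(i+1) - q^(-i-1)` where `q = A²`. -/
noncomputable def lam {F : Type*} [Field F] (A : F) (i : ℕ) : F :=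
  -(A ^ 2) ^ ((i : ℤ) + 1) - (A ^ 2) ^ (-(i : ℤ) - 1)

/-- `Q_{n,c}(z) = ∏_{i=c}^{c+n-1} (z - λ_i)`, so that `Q_{n,0} = Q_n`. -/
noncomputable def Qpolyc {F : Type*} [Field F] (A : F) (c n : ℕ) : Polynomial F :=
  ∏ i ∈ Finset.Ico c (c + n), (Polynomial.X - Polynomial.C (lam A i))

/-- `C^l_{m,n} = (-1)^l {m}!{n}!{m+n+1}! / ({m-l}!{n-l}!{m+n+1-l}!{l}!)`. -/
noncomputable def Ccoef {F : Type*} [Field F] (A : F) (l m n : ℕ) : F :=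
  (-1) ^ l * (qfact A m * qfact A n * qfact A (m + n + 1)) /
    (qfact A (m - l) * qfact A (n - l) * qfact A (m + n + 1 - l) * qfact A l)

/-- `a^k + a^(-k)` for `a = -A`. -/
noncomputable def qcosh {F : Type*} [Field F] (A : F) (k : ℤ) : F :=
  (-A) ^ k + (-A) ^ (-k)

/-- The falling product `{x}{x-1}⋯{x-l+1}`. -/
noncomputable def qfall {F : Type*} [Field F] (A : F) (x : ℤ) (l : ℕ) : F :=
  ∏ i ∈ Finset.range l, qint A (x - i)

/-- The coefficients `C^l_{m,n}` written with falling products, so that they vanish for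
`l > min m n`. -/
noncomputable def fallCoef {F : Type*} [Field F] (A : F) (l m n : ℕ) : F :=
  (-1) ^ l * (qfall A m l * qfall A n l * qfall A (m + n + 1) l) / qfact A l

section

variable {F : Type*} [Field F] {A : F}

lemma qcosh_neg (A : F) (k : ℤ) : qcosh A (-k) = qcosh A k := by
  simp only [qcosh, neg_neg, add_comm]

lemma qint_mul_qint (hA : A ≠ 0) (x y : ℤ) :
    qint A x * qint A y = qcosh A (x + y) - qcosh A (x - y) := by
  have h : -A ≠ 0 := neg_ne_zero.mpr hA
  simp only [qint, qcosh, sub_eq_add_neg, neg_add, neg_neg, zpow_add₀ h]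
  ring

lemma lam_eq_neg_qcosh (A : F) (i : ℕ) : lam A i = -qcosh A (2 * i + 2) := by
  have h (k : ℤ) : (A ^ 2) ^ k = (-A) ^ (2 * k) := by
    rw [zpow_mul, zpow_ofNat, neg_sq]
  rw [lam, qcosh, h, h]
  ring_nf

lemma lam_sub_lam (hA : A ≠ 0) (i j : ℕ) :
    lam A i - lam A j = -(qint A ((i : ℤ) - j) * qint A (i + j + 2)) := by
  rw [qint_mul_qint hA, lam_eq_neg_qcosh, lam_eq_neg_qcosh, ← qcosh_neg A (2 * j + 2)]
  ring_nf

lemma qint_zero (A : F) : qint A 0 = 0 := by simp [qint]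

lemma qfall_succ (A : F) (x : ℤ) (l : ℕ) :
    qfall A x (l + 1) = qfall A x l * qint A (x - l) :=
  Finset.prod_range_succ _ _

lemma qfall_succ_left (A : F) (x : ℤ) (l : ℕ) :
    qfall A (x + 1) (l + 1) = qint A (x + 1) * qfall A x l := by
  rw [qfall, Finset.prod_range_succ', qfall, mul_comm]
  simp

lemma qfall_eq_zero (A : F) {n l : ℕ} (h : n < l) : qfall A n l = 0 :=
  Finset.prod_eq_zero (Finset.mem_range.mpr h) (by simp [qint_zero])

lemma qfact_succ (A : F) (n : ℕ) : qfact A (n + 1) = qfact A n * qint A (n + 1) :=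
  Finset.prod_range_succ _ _

lemma qfact_sub_mul_qfall (A : F) {n l : ℕ} (h : l ≤ n) :
    qfact A (n - l) * qfall A n l = qfact A n := by
  induction l with
  | zero => simp [qfall]
  | succ l ih =>
    have e : n - l = n - (l + 1) + 1 := by omega
    have e' : ((n - (l + 1) : ℕ) : ℤ) + 1 = n - l := by omega
    rw [← ih (by omega), e, qfact_succ, qfall_succ, e']
    ring

lemma qfact_ne_zero {M n : ℕ} (hk : ∀ k : ℕ, 1 ≤ k → k ≤ M → qint A (k : ℤ) ≠ 0)
    (h : n ≤ M) : qfact A n ≠ 0 := by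
  refine Finset.prod_ne_zero_iff.mpr fun i hi => ?_
  have := Finset.mem_range.mp hi
  exact_mod_cast hk (i + 1) (by omega) (by omega)

lemma fallCoef_zero (A : F) (m n : ℕ) : fallCoef A 0 m n = 1 := by
  simp [fallCoef, qfall, qfact]

lemma fallCoef_eq_zero_left (A : F) {l m : ℕ} (n : ℕ) (h : m < l) : fallCoef A l m n = 0 := by
  simp [fallCoef, qfall_eq_zero A h]

lemma fallCoef_eq_zero_right (A : F) {l n : ℕ} (m : ℕ) (h : n < l) : fallCoef A l m n = 0 := by
  simp [fallCoef, qfall_eq_zero A h]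

lemma Ccoef_eq_fallCoef {l m n : ℕ}
    (hk : ∀ k : ℕ, 1 ≤ k → k ≤ m + n + 1 → qint A (k : ℤ) ≠ 0) (hm : l ≤ m) (hn : l ≤ n) :
    Ccoef A l m n = fallCoef A l m n := by
  have h1 := qfact_ne_zero hk (n := m - l) (by omega)
  have h2 := qfact_ne_zero hk (n := n - l) (by omega)
  have h3 := qfact_ne_zero hk (n := m + n + 1 - l) (by omega)
  have h4 := qfact_ne_zero hk (n := l) (by omega)
  have e := qfact_sub_mul_qfall A (n := m + n + 1) (l := l) (by omega)
  push_cast at e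
  rw [Ccoef, fallCoef, ← qfact_sub_mul_qfall A hm, ← qfact_sub_mul_qfall A hn, ← e]
  field_simp

/-- The Pascal-type recursion in `m` for the structure coefficients. -/
lemma fallCoef_succ_succ (hA : A ≠ 0) {l m : ℕ} (n : ℕ) (hlm : l ≤ m)
    (hk : ∀ k : ℕ, 1 ≤ k → k ≤ m + 1 → qint A (k : ℤ) ≠ 0) :
    fallCoef A (l + 1) (m + 1) n =
      fallCoef A (l + 1) m n + (lam A (m + n - l) - lam A m) * fallCoef A l m n := by
  have h1 : qfact A l ≠ 0 := qfact_ne_zero hk (by omega)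
  have h2 : qint A ((l : ℤ) + 1) ≠ 0 := by exact_mod_cast hk (l + 1) (by omega) (by omega)
  have key : qint A ((m : ℤ) + 1) * qint A ((m : ℤ) + n + 1 + 1) =
      qint A ((m : ℤ) - l) * qint A ((m : ℤ) + n + 1 - l) +
        qint A ((l : ℤ) + 1) * qint A (2 * (m : ℤ) + n - l + 2) := by
    simp only [qint_mul_qint hA]
    rw [← qcosh_neg A (m + 1 - _), ← qcosh_neg A (m - l - _), ← qcosh_neg A (l + 1 - _)]
    ring_nf
  have e1 : ((m + n - l : ℕ) : ℤ) - m = n - l := by omega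
  have e2 : ((m + n - l : ℕ) : ℤ) + m + 2 = 2 * m + n - l + 2 := by omega
  have e3 : ((m : ℤ) + 1) + n + 1 = m + n + 1 + 1 := by ring
  rw [lam_sub_lam hA, e1, e2]
  simp only [fallCoef, Nat.cast_add, Nat.cast_one, e3, qfall_succ_left A m, qfall_succ_left A (m + n + 1),
    qfall_succ, qfact_succ]
  field_simp
  linear_combination (-(-1 : F) ^ l * qfall A m l * qfall A n l * qfall A (m + n + 1) l *
    qint A (n - l)) * key

lemma Qpolyc_succ (A : F) (c n : ℕ) :
    Qpolyc A c (n + 1) = Qpolyc A c n * (X - C (lam A (c + n))) := by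
  rw [Qpolyc, ← add_assoc, Finset.prod_Ico_succ_top (by omega), Qpolyc]

lemma Qpolyc_mul_eq_sum_fallCoef (hA : A ≠ 0) (m n c : ℕ)
    (hk : ∀ k : ℕ, 1 ≤ k → k ≤ m → qint A (k : ℤ) ≠ 0) :
    Qpolyc A 0 m * Qpolyc A c n =
      ∑ l ∈ Finset.range (m + 1), C (fallCoef A l m (n + c)) * Qpolyc A c (m + n - l) := by
  induction m with
  | zero => simp [fallCoef_zero, Qpolyc]
  | succ m ih =>
    have step : ∀ l ∈ Finset.range (m + 1),
        C (fallCoef A l m (n + c)) * Qpolyc A c (m + n - l) * (X - C (lam A m)) =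
          C (fallCoef A l m (n + c)) * Qpolyc A c (m + 1 + n - l) +
          C ((lam A (m + (n + c) - l) - lam A m) * fallCoef A l m (n + c)) *
            Qpolyc A c (m + n - l) := by
      intro l hl
      have hl := Finset.mem_range.mp hl
      have e : m + 1 + n - l = m + n - l + 1 := by omega
      have e' : m + (n + c) - l = c + (m + n - l) := by omega
      rw [e, e', Qpolyc_succ, C_mul, C_sub]
      ring
    have extend : ∑ l ∈ Finset.range (m + 1),
        C (fallCoef A l m (n + c)) * Qpolyc A c (m + 1 + n - l) =
        ∑ l ∈ Finset.range (m + 1),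
          C (fallCoef A (l + 1) m (n + c)) * Qpolyc A c (m + n - l) +
          Qpolyc A c (m + 1 + n) := by
      have h := Finset.sum_range_succ
        (fun l => C (fallCoef A l m (n + c)) * Qpolyc A c (m + 1 + n - l)) (m + 1)
      rw [fallCoef_eq_zero_left A _ (Nat.lt_succ_self m), C_0, zero_mul, add_zero] at h
      rw [← h, Finset.sum_range_succ', fallCoef_zero, C_1, one_mul, Nat.sub_zero]
      congr 1
      refine Finset.sum_congr rfl fun l _ => ?_
      rw [show m + 1 + n - (l + 1) = m + n - l by omega]
    rw [Qpolyc_succ, zero_add, mul_right_comm, ih fun k h1 h2 => hk k h1 (by omega),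
      Finset.sum_mul, Finset.sum_congr rfl step, Finset.sum_add_distrib, extend,
      Finset.sum_range_succ' _ (m + 1), fallCoef_zero, C_1, one_mul, Nat.sub_zero,
      add_right_comm, ← Finset.sum_add_distrib]
    congr 1
    refine Finset.sum_congr rfl fun l hl => ?_
    have hl := Finset.mem_range.mp hl
    rw [fallCoef_succ_succ hA _ (by omega) hk, C_add, add_mul,
      show m + 1 + n - (l + 1) = m + n - l by omega]

end

/-- Proposition 4.7, general `c` (equation (4.2)):
`Q_m · Q_{n,c} = ∑_{l=0}^{min(m,n+c)} C^l_{m,n+c} Q_{m+n-l,c}` in `F[z]`. -/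
theorem stmt17 {F : Type*} [Field F] (A : F) (hA : A ≠ 0) (m n c : ℕ)
    (hk : ∀ k : ℕ, 1 ≤ k → k ≤ m + n + c + 1 → qint A (k : ℤ) ≠ 0) :
    Qpolyc A 0 m * Qpolyc A c n =
      ∑ l ∈ Finset.range (min m (n + c) + 1),
        Polynomial.C (Ccoef A l m (n + c)) * Qpolyc A c (m + n - l) := by
  rw [Qpolyc_mul_eq_sum_fallCoef hA m n c fun k h1 h2 => hk k h1 (by omega)]
  symm
  trans ∑ l ∈ Finset.range (min m (n + c) + 1),
      C (fallCoef A l m (n + c)) * Qpolyc A c (m + n - l)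
  · refine Finset.sum_congr rfl fun l hl => ?_
    have hl := Finset.mem_range.mp hl
    rw [Ccoef_eq_fallCoef (fun k h1 h2 => hk k h1 (by omega)) (by omega) (by omega)]
  · refine Finset.sum_subset (Finset.range_mono (by omega)) fun l hl hl' => ?_
    rw [Finset.mem_range] at hl hl'
    rw [fallCoef_eq_zero_right A _ (by omega), C_0, zero_mul]
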